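/- Let B = k[x,t,u,v]/(v²t − x²u − 1) be the coordinate ring of the smooth affine threefold V = {v²t − x²u = 1}. Then the localization of B at the image of x is isomorphic as a k-algebra to k[x, x^{−1}][t, v], and the localization of B at the image of v is isomorphic as a k-algebra to k[v, v^{−1}][x, u]; in particular the restriction of the projection pr_{x,v} makes V a Zariski locally trivial 𝔸¹-bundle over 𝔸² ∖ {0}, so V is weakly equivalent to 𝔸² ∖ {0}. -/

import Mathlib

open MvPolynomial

/-- The coordinate ring `B = k[x,t,u,v]/(v²t - x²u - 1)` of the smooth affine threefold
`V = {v²t - x²u = 1}` (variables `x = X 0`, `t = X 1`, `u = X 2`, `v = X 3`). -/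
abbrev vRing (k : Type) [Field k] : Type :=
  MvPolynomial (Fin 4) k ⧸
    Ideal.span {(X 3 ^ 2 * X 1 - X 0 ^ 2 * X 2 - 1 : MvPolynomial (Fin 4) k)}

/-- Evaluation of Laurent polynomials at a unit of a `k`-algebra. -/
noncomputable def LaurentPolynomial.aevalUnit {k A : Type*} [CommRing k] [CommRing A] [Algebra k A]
    (a : Aˣ) : LaurentPolynomial k →ₐ[k] A :=
  AddMonoidAlgebra.lift k A ℤ ((Units.coeHom A).comp (zpowersHom Aˣ a))

theorem LaurentPolynomial.aevalUnit_T {k A : Type*} [CommRing k] [CommRing A] [Algebra k A]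
    (a : Aˣ) (n : ℤ) :
    LaurentPolynomial.aevalUnit (k := k) a (LaurentPolynomial.T n) = ((a ^ n : Aˣ) : A) := by
  refine (AddMonoidAlgebra.lift_single _ n (1 : k)).trans ?_
  simp

theorem LaurentPolynomial.algHom_ext_T_one {k A : Type*} [CommRing k] [CommRing A] [Algebra k A]
    {f g : LaurentPolynomial k →ₐ[k] A}
    (h : f (LaurentPolynomial.T 1) = g (LaurentPolynomial.T 1)) : f = g :=
  AddMonoidAlgebra.algHom_ext' (R := k) (A := k) (M := ℤ) (MonoidHom.ext_mint h)
    (Subsingleton.elim _ _)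

/-- Let `φ n` be polynomials over `k[T,T⁻¹]` in variables indexed by `τ` that satisfy the
relation `p`, with `φ i = T` and `φ (j s) = X s`. If every solution `y` of `p` in the localization
of `k[X]/(p)` at `X i` is determined by `y i` and the `y (j s)` through `φ`, then this
localization is the polynomial ring over `k[T,T⁻¹]` in the variables indexed by `τ`. -/
theorem nonempty_localizationAway_quotient_algEquiv {k : Type*} [Field k] {σ τ : Type*}
    (p : MvPolynomial σ k) (i : σ) (j : τ → σ)
    (φ : σ → MvPolynomial τ (LaurentPolynomial k))
    (hp : aeval φ p = 0) (hi : φ i = C (LaurentPolynomial.T 1)) (hj : ∀ s, φ (j s) = X s)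
    (hφ : ∀ (g : MvPolynomial τ (LaurentPolynomial k) →ₐ[k]
        Localization.Away (Ideal.Quotient.mk (Ideal.span {p}) (X i))) (y : σ → _),
      aeval y p = 0 → g (C (LaurentPolynomial.T 1)) = y i → (∀ s, g (X s) = y (j s)) →
      ∀ n, g (φ n) = y n) :
    Nonempty (Localization.Away (Ideal.Quotient.mk (Ideal.span {p}) (X i)) ≃ₐ[k]
      MvPolynomial τ (LaurentPolynomial k)) := by
  set b := Ideal.Quotient.mk (Ideal.span {p}) (X i) with hb
  let q : (MvPolynomial σ k ⧸ Ideal.span {p}) →ₐ[k] MvPolynomial τ (LaurentPolynomial k) :=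
    Ideal.Quotient.liftₐ _ (aeval φ) (by
      intro a ha
      obtain ⟨c, rfl⟩ := Ideal.mem_span_singleton.1 ha
      rw [map_mul, hp, zero_mul])
  have hq : ∀ n, q (Ideal.Quotient.mk _ (X n)) = φ n := fun n =>
    (Ideal.Quotient.lift_mk _ _ _).trans (aeval_X φ n)
  have hqb : IsUnit (q b) := by
    rw [hb, hq, hi]
    exact (LaurentPolynomial.isUnit_T 1).map C
  let f : Localization.Away b →ₐ[k] MvPolynomial τ (LaurentPolynomial k) :=
    IsLocalization.liftAlgHom (M := Submonoid.powers b) (f := q) (by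
      rintro ⟨_, n, rfl⟩
      simpa using hqb.pow n)
  let y : σ → Localization.Away b := fun n =>
    algebraMap _ _ (Ideal.Quotient.mk (Ideal.span {p}) (X n))
  have hf : ∀ n, f (y n) = φ n := fun n => (IsLocalization.lift_eq _ _).trans (hq n)
  have hy : aeval y p = 0 := by
    have : aeval y = (Algebra.algHom k _ (Localization.Away b)).comp
        (Ideal.Quotient.mkₐ k (Ideal.span {p})) :=
      MvPolynomial.algHom_ext fun n => aeval_X y n
    rw [this, AlgHom.comp_apply, Ideal.Quotient.mkₐ_eq_mk,
      Ideal.Quotient.eq_zero_iff_mem.2 (Ideal.mem_span_singleton_self p), map_zero]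
  have hu : IsUnit (y i) := IsLocalization.Away.algebraMap_isUnit b
  let g : MvPolynomial τ (LaurentPolynomial k) →ₐ[k] Localization.Away b :=
    aevalTower (LaurentPolynomial.aevalUnit hu.unit) fun s => y (j s)
  have hgT : g (C (LaurentPolynomial.T 1)) = y i := by
    simp [g, LaurentPolynomial.aevalUnit_T]
  have hgX : ∀ s, g (X s) = y (j s) := fun s => by simp [g]
  refine ⟨AlgEquiv.ofAlgHom f g ?_ ?_⟩
  · refine MvPolynomial.algHom_ext' ?_ fun s => ?_
    · refine LaurentPolynomial.algHom_ext_T_one ?_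
      change f (g (C (LaurentPolynomial.T 1))) = C (LaurentPolynomial.T 1)
      rw [hgT, hf, hi]
    · change f (g (X s)) = X s
      rw [hgX, hf, hj]
  · refine IsLocalization.algHom_ext (Submonoid.powers b) ?_
    refine Ideal.Quotient.algHom_ext _ ?_
    refine MvPolynomial.algHom_ext fun n => ?_
    change g (f (y n)) = y n
    rw [hf]
    exact hφ g y hy hgT hgX n

theorem MvPolynomial.C_T_neg_two_mul_sq {k σ : Type*} [Field k] :
    (C (LaurentPolynomial.T (-2)) * C (LaurentPolynomial.T 1) ^ 2 :
      MvPolynomial σ (LaurentPolynomial k)) = 1 := by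
  rw [← map_pow, ← map_mul, LaurentPolynomial.T_pow, ← LaurentPolynomial.T_add]
  simp

/-- The localization of `B = k[x,t,u,v]/(v²t - x²u - 1)` at the image of `x` is
isomorphic to `k[x,x⁻¹][t,v]`, and its localization at the image of `v` is isomorphic
to `k[v,v⁻¹][x,u]`; thus `pr_{x,v}` makes `V` a Zariski locally trivial `𝔸¹`-bundle over
`𝔸² ∖ {0}`. -/
theorem vRing_localizations (k : Type) [Field k] [CharZero k] :
    Nonempty (Localization.Away
        (Ideal.Quotient.mk
          (Ideal.span {(X 3 ^ 2 * X 1 - X 0 ^ 2 * X 2 - 1 : MvPolynomial (Fin 4) k)}) (X 0))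
      ≃ₐ[k] MvPolynomial (Fin 2) (LaurentPolynomial k)) ∧
    Nonempty (Localization.Away
        (Ideal.Quotient.mk
          (Ideal.span {(X 3 ^ 2 * X 1 - X 0 ^ 2 * X 2 - 1 : MvPolynomial (Fin 4) k)}) (X 3))
      ≃ₐ[k] MvPolynomial (Fin 2) (LaurentPolynomial k)) := by
  constructor
  · refine nonempty_localizationAway_quotient_algEquiv _ 0 ![1, 3]
      ![C (LaurentPolynomial.T 1), X 0,
        C (LaurentPolynomial.T (-2)) * (X 1 ^ 2 * X 0 - 1), X 1] ?_ rfl ?_ ?_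
    · simp only [map_sub, map_mul, map_pow, aeval_X, map_one, Matrix.cons_val]
      linear_combination (-(X 1 ^ 2 * X 0 - 1)) * C_T_neg_two_mul_sq (k := k) (σ := Fin 2)
    · intro s
      fin_cases s <;> rfl
    · intro g y hr hT hX n
      have h := congrArg g (C_T_neg_two_mul_sq (k := k) (σ := Fin 2))
      have h0 := hX 0
      have h1 := hX 1
      simp only [map_mul, map_pow, map_one, map_sub, aeval_X, hT, Matrix.cons_val] at h hr h0 h1
      fin_cases n
      · exact hT
      · exact h0
      · simp only [Fin.reduceFinMk, Matrix.cons_val, map_mul, map_sub, map_pow, map_one, h0, h1]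
        linear_combination g (C (LaurentPolynomial.T (-2))) * hr + y 2 * h
      · exact h1
  · refine nonempty_localizationAway_quotient_algEquiv _ 3 ![0, 2]
      ![X 0, C (LaurentPolynomial.T (-2)) * (1 + X 0 ^ 2 * X 1), X 1,
        C (LaurentPolynomial.T 1)] ?_ rfl ?_ ?_
    · simp only [map_sub, map_mul, map_pow, aeval_X, map_one, Matrix.cons_val]
      linear_combination (1 + X 0 ^ 2 * X 1) * C_T_neg_two_mul_sq (k := k) (σ := Fin 2)
    · intro s
      fin_cases s <;> rfl
    · intro g y hr hT hX n
      have h := congrArg g (C_T_neg_two_mul_sq (k := k) (σ := Fin 2))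
      have h0 := hX 0
      have h1 := hX 1
      simp only [map_mul, map_pow, map_one, map_sub, aeval_X, hT, Matrix.cons_val] at h hr h0 h1
      fin_cases n
      · exact h0
      · simp only [Fin.reduceFinMk, Matrix.cons_val, map_mul, map_add, map_pow, map_one, h0, h1]
        linear_combination -g (C (LaurentPolynomial.T (-2))) * hr + y 1 * h
      · exact h1
      · exact hT
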